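/- Let α ∈ (0,1). There exists a constant C(α) > 0 depending only on α such that for every c₀ > 0 and every t > 0 one has ∫₀ᵗ (t-s)^{α-1} E_{α,α}(-c₀ (t-s)^α) s^{-α} ds ≤ (C(α)/c₀) t^{-α}. -/

import Mathlib

open MeasureTheory Set Filter

/-- The Mittag-Leffler function `E_{α,β}(z) = Σ_{k=0}^∞ z^k / Γ(αk+β)`. -/
noncomputable def mittagLeffler (α β z : ℝ) : ℝ :=
  ∑' k : ℕ, z ^ k / Real.Gamma (α * k + β)

lemma rpow_mul_exp_neg_le_Gamma_add_one {R y : ℝ} (hR : 0 < R) (hy : 0 ≤ y) :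
    R ^ y * Real.exp (-R) ≤ Real.Gamma (y + 1) := by
  rw [Real.Gamma_eq_integral (by linarith), ← integral_exp_neg_Ioi, ← integral_const_mul]
  have hint := Real.GammaIntegral_convergent (s := y + 1) (by linarith)
  calc ∫ x in Ioi R, R ^ y * Real.exp (-x)
      ≤ ∫ x in Ioi R, Real.exp (-x) * x ^ (y + 1 - 1) := by
        refine setIntegral_mono_on ((integrableOn_exp_neg_Ioi R).const_mul _)
          (hint.mono_set (Ioi_subset_Ioi hR.le)) measurableSet_Ioi fun x hx => ?_
        rw [mul_comm, add_sub_cancel_right]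
        gcongr
        exact le_of_lt hx
    _ ≤ ∫ x in Ioi 0, Real.exp (-x) * x ^ (y + 1 - 1) := by
        refine setIntegral_mono_set hint ?_ (Ioi_subset_Ioi hR.le).eventuallyLE
        filter_upwards [ae_restrict_mem measurableSet_Ioi] with x hx
        have : (0 : ℝ) < x := hx
        simp only [Pi.zero_apply]
        positivity

lemma summable_pow_div_Gamma {α β : ℝ} (hα : 0 < α) (hβ : 0 < β) (r : ℝ) :
    Summable fun k : ℕ => |1 / Real.Gamma (α * k + β)| * |r| ^ k := by
  set Q : ℝ := 2 * (|r| + 1) with hQ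
  have hQ0 : 0 < Q := by positivity
  set R : ℝ := Q ^ (1 / α) with hR
  have hR0 : 0 < R := by positivity
  have hs : Summable fun k : ℕ =>
      Real.exp R / R ^ β * ((α * k + β) * (1 / 2 : ℝ) ^ k) := by
    have h1 := summable_pow_mul_geometric_of_norm_lt_one 1 (r := (1 / 2 : ℝ)) (by norm_num)
    have h0 := summable_pow_mul_geometric_of_norm_lt_one 0 (r := (1 / 2 : ℝ)) (by norm_num)
    refine (((h1.mul_left α).add (h0.mul_left β)).congr fun k => ?_).mul_left _
    simp only [pow_one, pow_zero]
    ring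
  refine hs.of_nonneg_of_le (fun k => by positivity) fun k => ?_
  have hy : 0 < α * k + β := by positivity
  have hG := Real.Gamma_pos_of_pos hy
  have h := rpow_mul_exp_neg_le_Gamma_add_one hR0 hy.le
  rw [Real.Gamma_add_one hy.ne', Real.rpow_add hR0, Real.rpow_mul hR0.le, hR,
    ← Real.rpow_mul hQ0.le, one_div_mul_cancel hα.ne', Real.rpow_one, ← hR, Real.rpow_natCast,
    Real.exp_neg] at h
  have hr : |r| ^ k ≤ Q ^ k * (1 / 2) ^ k := by
    rw [← mul_pow]
    gcongr
    rw [hQ]; linarith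
  rw [abs_of_pos (by positivity)]
  have hE := Real.exp_pos R
  have hRb : 0 < R ^ β := by positivity
  calc 1 / Real.Gamma (α * k + β) * |r| ^ k
      ≤ 1 / Real.Gamma (α * k + β) * (Q ^ k * (1 / 2) ^ k) := by gcongr
    _ = Real.exp R / R ^ β * (1 / 2 : ℝ) ^ k / Real.Gamma (α * k + β) *
        (Q ^ k * R ^ β * (Real.exp R)⁻¹) := by field_simp
    _ ≤ Real.exp R / R ^ β * (1 / 2 : ℝ) ^ k / Real.Gamma (α * k + β) *
        ((α * k + β) * Real.Gamma (α * k + β)) := by gcongr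
    _ = _ := by field_simp

lemma summable_mittagLeffler {α β : ℝ} (hα : 0 < α) (hβ : 0 < β) (z : ℝ) :
    Summable fun k : ℕ => z ^ k / Real.Gamma (α * k + β) := by
  refine ((summable_pow_div_Gamma hα hβ z).congr fun k => ?_).of_norm
  rw [Real.norm_eq_abs, abs_div, abs_div, abs_pow, abs_one]
  ring

/-- Termwise differentiation of an everywhere absolutely convergent real power series. -/
lemma hasDerivAt_tsum_mul_pow {a : ℕ → ℝ} (ha : ∀ r : ℝ, Summable fun k => |a k| * |r| ^ k)
    (x : ℝ) :
    HasDerivAt (fun z => ∑' k, a k * z ^ k) (∑' k : ℕ, (k + 1) * a (k + 1) * x ^ k) x := by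
  set R : ℝ := |x| + 1 with hR
  have hR1 : 1 ≤ R := by simp [hR]
  have hs : Summable fun k => |a k| * |x| ^ k := ha x
  have hu : Summable fun k : ℕ => |a k| * |2 * R| ^ k := ha (2 * R)
  have hb : ∀ (k : ℕ) (y : ℝ), y ∈ Metric.ball (0 : ℝ) R →
      ‖a k * (k * y ^ (k - 1))‖ ≤ |a k| * |2 * R| ^ k := by
    intro k y hy
    have hy' : |y| ≤ R := by
      rw [mem_ball_zero_iff] at hy
      exact hy.le
    rw [Real.norm_eq_abs, abs_mul, abs_mul, abs_pow, Nat.abs_cast,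
      abs_of_pos (by positivity : (0 : ℝ) < 2 * R), mul_pow]
    gcongr
    · exact_mod_cast Nat.lt_two_pow_self.le
    · exact (pow_le_pow_left₀ (abs_nonneg y) hy' _).trans
        (pow_le_pow_right₀ hR1 (Nat.sub_le k 1))
  have hx : x ∈ Metric.ball (0 : ℝ) R := by
    rw [mem_ball_zero_iff, Real.norm_eq_abs]
    linarith
  have h := hasDerivAt_tsum_of_isPreconnected (g := fun k z => a k * z ^ k)
    (g' := fun k z => a k * (k * z ^ (k - 1))) hu Metric.isOpen_ball
    (convex_ball (0 : ℝ) R).isPreconnected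
    (fun k y _ => (hasDerivAt_pow k y).const_mul (a k)) hb hx
    (Summable.of_norm (hs.congr fun k => by simp)) hx
  refine h.congr_deriv ?_
  rw [(Summable.of_norm_bounded hu fun k => hb k x hx).tsum_eq_zero_add]
  simp only [Nat.cast_zero, zero_mul, mul_zero, zero_add, Nat.cast_add, Nat.cast_one,
    Nat.add_sub_cancel]
  exact tsum_congr fun k => by ring

lemma hasDerivAt_mittagLeffler_aux {α β : ℝ} (hα : 0 < α) (hβ : 0 < β) (x : ℝ) :
    HasDerivAt (mittagLeffler α β)
      (∑' k : ℕ, (k + 1) * (1 / Real.Gamma (α * (k + 1 : ℕ) + β)) * x ^ k) x := by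
  have h := hasDerivAt_tsum_mul_pow (summable_pow_div_Gamma hα hβ) x
  refine h.congr_of_eventuallyEq (Eventually.of_forall fun z => ?_)
  exact tsum_congr fun k => by ring

lemma continuous_mittagLeffler {α β : ℝ} (hα : 0 < α) (hβ : 0 < β) :
    Continuous (mittagLeffler α β) :=
  continuous_iff_continuousAt.2 fun x => (hasDerivAt_mittagLeffler_aux hα hβ x).continuousAt

lemma hasDerivAt_mittagLeffler_one {α : ℝ} (hα : 0 < α) (x : ℝ) :
    HasDerivAt (mittagLeffler α 1) (mittagLeffler α α x / α) x := by
  refine (hasDerivAt_mittagLeffler_aux hα one_pos x).congr_deriv ?_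
  rw [mittagLeffler, ← tsum_div_const]
  refine tsum_congr fun k => ?_
  have hy : 0 < α * k + α := by positivity
  have hG := Real.Gamma_pos_of_pos hy
  rw [show α * ((k + 1 : ℕ) : ℝ) + 1 = (α * k + α) + 1 by push_cast; ring,
    Real.Gamma_add_one hy.ne']
  field_simp

lemma mittagLeffler_one_zero (α : ℝ) : mittagLeffler α 1 0 = 1 := by
  rw [mittagLeffler, tsum_eq_single 0]
  · simp
  · intro k hk
    simp [hk]

lemma integral_rpow_mul_sub_rpow {a b t : ℝ} (ha : 0 < a) (hb : 0 < b) (ht : 0 < t) :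
    ∫ s in Ioo 0 t, s ^ (a - 1) * (t - s) ^ (b - 1) =
      t ^ (a + b - 1) * (Real.Gamma a * Real.Gamma b / Real.Gamma (a + b)) := by
  have h := Complex.betaIntegral_scaled a b ht
  rw [Complex.betaIntegral_eq_Gamma_mul_div _ _ (by simpa) (by simpa),
    intervalIntegral.integral_of_le ht.le, integral_Ioc_eq_integral_Ioo] at h
  apply Complex.ofReal_injective
  rw [← integral_complex_ofReal]
  convert h using 1
  · refine setIntegral_congr_fun measurableSet_Ioo fun s hs => ?_
    simp only [Complex.ofReal_mul]
    rw [Complex.ofReal_cpow hs.1.le, Complex.ofReal_cpow (sub_nonneg.2 hs.2.le)]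
    push_cast
    rfl
  · rw [← Complex.ofReal_add a b]
    simp only [Complex.Gamma_ofReal]
    push_cast
    rw [Complex.ofReal_cpow ht.le]
    push_cast
    rfl

lemma integrableOn_rpow_mul_sub_rpow {a b t : ℝ} (ha : 0 < a) (hb : 0 < b) (ht : 0 < t) :
    IntegrableOn (fun s => s ^ (a - 1) * (t - s) ^ (b - 1)) (Ioo 0 t) := by
  by_contra hn
  have h := integral_rpow_mul_sub_rpow ha hb ht
  rw [integral_undef hn] at h
  have h1 := Real.Gamma_pos_of_pos ha
  have h2 := Real.Gamma_pos_of_pos hb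
  have h3 := Real.Gamma_pos_of_pos (add_pos ha hb)
  have : 0 < t ^ (a + b - 1) * (Real.Gamma a * Real.Gamma b / Real.Gamma (a + b)) := by positivity
  exact this.ne h

lemma integrableOn_rpow_mul_mittagLeffler_mul_sub_rpow {α : ℝ} (hα : α ∈ Ioo (0 : ℝ) 1) (c : ℝ)
    {t : ℝ} (ht : 0 < t) :
    IntegrableOn (fun s => s ^ (α - 1) * mittagLeffler α α (-(c * s ^ α)) * (t - s) ^ (-α))
      (Ioo 0 t) := by
  have hcont : Continuous fun s : ℝ => mittagLeffler α α (-(c * s ^ α)) :=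
    (continuous_mittagLeffler hα.1 hα.1).comp
      ((continuous_const.mul (Real.continuous_rpow_const hα.1.le)).neg)
  have hint := integrableOn_rpow_mul_sub_rpow hα.1 (sub_pos.2 hα.2) ht
  obtain ⟨M, hM⟩ := (isCompact_Icc (a := (0 : ℝ)) (b := t)).exists_bound_of_continuousOn
    hcont.continuousOn
  refine (Integrable.bdd_mul (c := M) hint hcont.aestronglyMeasurable ?_).congr ?_
  · filter_upwards [ae_restrict_mem measurableSet_Ioo] with s hs
    exact hM s (Ioo_subset_Icc_self hs)
  · refine Eventually.of_forall fun s => ?_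
    simp only
    rw [show (1 - α - 1 : ℝ) = -α by ring]
    ring

lemma integral_rpow_mul_mittagLeffler_mul_sub_rpow {α : ℝ} (hα : α ∈ Ioo (0 : ℝ) 1) (c : ℝ)
    {t : ℝ} (ht : 0 < t) :
    ∫ s in Ioo 0 t, s ^ (α - 1) * mittagLeffler α α (-(c * s ^ α)) * (t - s) ^ (-α) =
      Real.Gamma (1 - α) * mittagLeffler α 1 (-(c * t ^ α)) := by
  have hα0 := hα.1
  have hα1 : 0 < 1 - α := sub_pos.2 hα.2
  set B : ℕ → ℝ → ℝ := fun k s => s ^ (α * k + α - 1) * (t - s) ^ (1 - α - 1) with hB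
  set F : ℕ → ℝ → ℝ := fun k s => (-c) ^ k / Real.Gamma (α * k + α) * B k s with hF
  have hy : ∀ k : ℕ, 0 < α * k + α := fun k => by positivity
  have hBint : ∀ k, IntegrableOn (B k) (Ioo 0 t) := fun k =>
    integrableOn_rpow_mul_sub_rpow (hy k) hα1 ht
  have hBval : ∀ (d : ℝ) (k : ℕ), d ^ k / Real.Gamma (α * k + α) * ∫ s in Ioo 0 t, B k s =
      Real.Gamma (1 - α) * ((d * t ^ α) ^ k / Real.Gamma (α * k + 1)) := by
    intro d k
    have hG := Real.Gamma_pos_of_pos (hy k)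
    rw [hB, integral_rpow_mul_sub_rpow (hy k) hα1 ht,
      show α * k + α + (1 - α) - 1 = α * k by ring,
      show α * k + α + (1 - α) = α * k + 1 by ring, Real.rpow_mul ht.le, Real.rpow_natCast, mul_pow]
    field_simp
  have hFint : ∀ k, Integrable (F k) (volume.restrict (Ioo 0 t)) := fun k =>
    (hBint k).const_mul _
  have hnorm : ∀ k, ∫ s in Ioo 0 t, ‖F k s‖ =
      Real.Gamma (1 - α) * ((|c| * t ^ α) ^ k / Real.Gamma (α * k + 1)) := by
    intro k
    rw [← hBval, ← integral_const_mul]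
    refine setIntegral_congr_fun measurableSet_Ioo fun s hs => ?_
    have h1 : 0 < t - s := sub_pos.2 hs.2
    have h2 : 0 < s := hs.1
    have hG := Real.Gamma_pos_of_pos (hy k)
    have hB0 : 0 ≤ B k s := by simp only [hB]; positivity
    simp only [hF, Real.norm_eq_abs, abs_mul, abs_div, abs_pow, abs_neg, abs_of_nonneg hB0,
      abs_of_pos hG]
  have hsum : Summable fun k => ∫ s in Ioo 0 t, ‖F k s‖ := by
    simp only [hnorm]
    exact (summable_mittagLeffler hα0 one_pos _).mul_left _
  have h := integral_tsum_of_summable_integral_norm hFint hsum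
  have hL : ∑' k, ∫ s in Ioo 0 t, F k s =
      Real.Gamma (1 - α) * mittagLeffler α 1 (-(c * t ^ α)) := by
    rw [mittagLeffler, ← tsum_mul_left]
    refine tsum_congr fun k => ?_
    rw [hF, integral_const_mul, hBval, neg_mul]
  rw [← hL, h]
  refine setIntegral_congr_fun measurableSet_Ioo fun s hs => ?_
  have h2 : 0 < s := hs.1
  simp only [mittagLeffler, hF, hB]
  rw [← tsum_mul_left, ← tsum_mul_right]
  refine tsum_congr fun k => ?_
  rw [show α * (k : ℝ) + α - 1 = (α - 1) + α * k by ring, Real.rpow_add h2, Real.rpow_mul h2.le,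
    Real.rpow_natCast, ← neg_mul, mul_pow, show (1 - α - 1 : ℝ) = -α by ring]
  ring

/-- At a minimum point `T` of `f` on `[0, T]`, the Caputo derivative of `f` is nonpositive. -/
lemma integral_sub_rpow_mul_deriv_nonpos {α T : ℝ} (hα : 0 < α) (hα1 : α < 1) (hT : 0 < T)
    {f f' : ℝ → ℝ} (hf : ContinuousOn f (Icc 0 T)) (hf' : ∀ s, 0 < s → HasDerivAt f (f' s) s)
    (hf'c : ContinuousOn f' (Ioi 0))
    (hint : IntegrableOn (fun s => f' s * (T - s) ^ (-α)) (Ioo 0 T))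
    (hmin : ∀ s ∈ Icc 0 T, f T ≤ f s) :
    ∫ s in Ioo 0 T, f' s * (T - s) ^ (-α) ≤ 0 := by
  set φ : ℝ → ℝ := fun s => f' s * (T - s) ^ (-α) with hφ
  have hii : IntervalIntegrable φ volume 0 T :=
    (intervalIntegrable_iff_integrableOn_Ioo_of_le hT.le).2 hint
  rw [← integral_Ioc_eq_integral_Ioo, ← intervalIntegral.integral_of_le hT.le]
  have hprim : ContinuousOn (fun r => ∫ s in (0 : ℝ)..r, φ s) (Icc 0 T) := by
    have := intervalIntegral.continuousOn_primitive_interval' hii left_mem_uIcc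
    rwa [uIcc_of_le hT.le] at this
  have hle : ∀ r ∈ Ioo 0 T, ∫ s in (0 : ℝ)..r, φ s ≤ (T - r) ^ (-α) * (f r - f T) := by
    intro r hr
    set H : ℝ → ℝ := fun s => (T - s) ^ (-α) * (f s - f T) - ∫ x in (0 : ℝ)..s, φ x with hH
    have hsub : Icc 0 r ⊆ Icc 0 T := Icc_subset_Icc_right hr.2.le
    have hHc : ContinuousOn H (Icc 0 r) := by
      refine ContinuousOn.sub (ContinuousOn.mul ?_ ((hf.mono hsub).sub continuousOn_const))
        (hprim.mono hsub)
      refine ContinuousOn.rpow_const (by fun_prop) fun s hs => Or.inl ?_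
      linarith [hs.2, hr.2]
    have hHd : ∀ s ∈ interior (Icc 0 r),
        HasDerivAt H (α * (T - s) ^ (-α - 1) * (f s - f T)) s := by
      intro s hs
      rw [interior_Icc] at hs
      have hTs : 0 < T - s := by linarith [hs.2, hr.2]
      have hφc : ContinuousOn φ (Ioo 0 T) := by
        refine (hf'c.mono fun x hx => hx.1).mul (ContinuousOn.rpow_const (by fun_prop)
          fun x hx => Or.inl (sub_pos.2 hx.2).ne')
      have hsT : s ∈ Ioo 0 T := ⟨hs.1, hs.2.trans hr.2⟩
      have h1 : HasDerivAt (fun u => ∫ x in (0 : ℝ)..u, φ x) (φ s) s :=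
        intervalIntegral.integral_hasDerivAt_right
          (hii.mono_set (by rw [uIcc_of_le hs.1.le, uIcc_of_le hT.le]
                            exact Icc_subset_Icc_right hsT.2.le))
          (hφc.stronglyMeasurableAtFilter isOpen_Ioo s hsT)
          (hφc.continuousAt (isOpen_Ioo.mem_nhds hsT))
      have h2 : HasDerivAt (fun u => (T - u) ^ (-α)) (-1 * (-α) * (T - s) ^ (-α - 1)) s :=
        ((hasDerivAt_id s).const_sub T).rpow_const (Or.inl hTs.ne')
      refine ((h2.mul ((hf' s hs.1).sub_const (f T))).sub h1).congr_deriv ?_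
      simp only [hφ]
      ring
    have hmono : MonotoneOn H (Icc 0 r) := by
      refine monotoneOn_of_deriv_nonneg (convex_Icc 0 r) hHc
        (fun s hs => (hHd s hs).differentiableAt.differentiableWithinAt) fun s hs => ?_
      rw [(hHd s hs).deriv]
      rw [interior_Icc] at hs
      have hTs : 0 < T - s := by linarith [hs.2, hr.2]
      have := sub_nonneg.2 (hmin s ⟨hs.1.le, (hs.2.trans hr.2).le⟩)
      positivity
    have h0 : 0 ≤ H 0 := by
      have := sub_nonneg.2 (hmin 0 ⟨le_rfl, hT.le⟩)
      simp only [hH, intervalIntegral.integral_same, sub_zero]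
      positivity
    have := h0.trans (hmono ⟨le_rfl, hr.1.le⟩ ⟨hr.1.le, le_rfl⟩ hr.1.le)
    simp only [hH] at this
    linarith
  have hmem : Ioo 0 T ∈ nhdsWithin T (Iio T) := Ioo_mem_nhdsLT hT
  have hlim1 : Tendsto (fun r => ∫ s in (0 : ℝ)..r, φ s) (nhdsWithin T (Iio T))
      (nhds (∫ s in (0 : ℝ)..T, φ s)) :=
    (hprim T ⟨hT.le, le_rfl⟩).tendsto.mono_left
      (nhdsWithin_le_iff.2 (mem_of_superset hmem Ioo_subset_Icc_self))
  have hlim2 : Tendsto (fun r => (T - r) ^ (-α) * (f r - f T)) (nhdsWithin T (Iio T))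
      (nhds 0) := by
    have hs : Tendsto (fun r => -slope f T r * (T - r) ^ (1 - α)) (nhdsWithin T (Iio T))
        (nhds (-f' T * (T - T) ^ (1 - α))) := by
      refine Tendsto.mul (Tendsto.neg ?_) ?_
      · exact (hasDerivAt_iff_tendsto_slope.1 (hf' T hT)).mono_left
          (nhdsWithin_mono _ fun x hx => ne_of_lt hx)
      · have : ContinuousAt (fun r : ℝ => (T - r) ^ (1 - α)) T :=
          (continuousAt_const.sub continuousAt_id).rpow_const (Or.inr (by linarith))
        exact this.tendsto.mono_left nhdsWithin_le_nhds
    rw [sub_self, Real.zero_rpow (by linarith), mul_zero] at hs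
    refine hs.congr' ?_
    filter_upwards [self_mem_nhdsWithin] with r hr
    have hTr : 0 < T - r := sub_pos.2 hr
    have hrT : r - T ≠ 0 := by linarith
    rw [slope_def_field, show 1 - α = -α + 1 by ring, Real.rpow_add_one hTr.ne']
    field_simp
    ring
  exact le_of_tendsto_of_tendsto hlim1 hlim2 (mem_of_superset hmem hle)

lemma integrableOn_one_add_rpow_mul_sub_rpow {α t : ℝ} (hα1 : α < 1) (ht : 0 < t) (p : ℝ) :
    IntegrableOn (fun s : ℝ => (1 + s) ^ p * (t - s) ^ (-α)) (Ioo 0 t) := by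
  have hint : IntegrableOn (fun s : ℝ => (t - s) ^ (-α)) (Ioo 0 t) := by
    simpa using integrableOn_rpow_mul_sub_rpow one_pos (sub_pos.2 hα1) ht
  have hcont : ContinuousOn (fun s : ℝ => (1 + s) ^ p) (Icc 0 t) :=
    ContinuousOn.rpow_const (by fun_prop) fun s hs => Or.inl (by linarith [hs.1])
  obtain ⟨M, hM⟩ := isCompact_Icc.exists_bound_of_continuousOn hcont
  refine Integrable.bdd_mul (c := M) hint
    ((hcont.mono Ioo_subset_Icc_self).aestronglyMeasurable measurableSet_Ioo) ?_
  filter_upwards [ae_restrict_mem measurableSet_Ioo] with s hs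
  exact hM s (Ioo_subset_Icc_self hs)

lemma integral_one_add_rpow_le {α t : ℝ} (hα : 0 < α) (ht : 0 < t) :
    ∫ s in Ioo 0 t, (1 + s) ^ (-α - 1) ≤ 1 / α := by
  rw [← integral_Ioc_eq_integral_Ioo, ← intervalIntegral.integral_of_le ht.le,
    intervalIntegral.integral_comp_add_left (fun x : ℝ => x ^ (-α - 1)) 1,
    integral_rpow (Or.inr ⟨by linarith, by
      rw [uIcc_of_le (by linarith)]
      intro h
      linarith [h.1]⟩)]
  have : 0 ≤ (1 + t) ^ (-α) := by positivity
  rw [sub_add_cancel, add_zero, Real.one_rpow, div_neg, ← neg_div]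
  gcongr
  linarith

lemma integral_sub_rpow {α t : ℝ} (hα1 : α < 1) (ht : 0 < t) :
    ∫ s in Ioo 0 t, (t - s) ^ (-α) = t ^ (1 - α) / (1 - α) := by
  have h1 : 0 < 1 - α := sub_pos.2 hα1
  have hG := Real.Gamma_pos_of_pos h1
  have h := integral_rpow_mul_sub_rpow one_pos h1 ht
  simp only [sub_self, Real.rpow_zero, one_mul, Real.Gamma_one] at h
  rw [show 1 - α - 1 = -α by ring, show 1 + (1 - α) = (1 - α) + 1 by ring,
    Real.Gamma_add_one h1.ne', add_sub_cancel_right] at h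
  rw [h]
  field_simp

lemma rpow_mul_rpow_le_add {α a b m : ℝ} (hα : 0 < α) (ha : 0 < a) (hb : 0 < b) (hm : 0 < m)
    (hab : 2 * m ≤ a + b) :
    b ^ (-α - 1) * a ^ (-α) ≤ m ^ (-α) * b ^ (-α - 1) + m ^ (-α - 1) * a ^ (-α) := by
  rcases le_total m a with h | h
  · have h1 : a ^ (-α) ≤ m ^ (-α) := Real.rpow_le_rpow_of_nonpos hm h (by linarith)
    have h2 : 0 ≤ m ^ (-α - 1) * a ^ (-α) := by positivity
    have h3 : b ^ (-α - 1) * a ^ (-α) ≤ b ^ (-α - 1) * m ^ (-α) := by gcongr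
    linarith
  · have h1 : b ^ (-α - 1) ≤ m ^ (-α - 1) :=
      Real.rpow_le_rpow_of_nonpos hm (by linarith) (by linarith)
    have h2 : 0 ≤ m ^ (-α) * b ^ (-α - 1) := by positivity
    have h3 : b ^ (-α - 1) * a ^ (-α) ≤ m ^ (-α - 1) * a ^ (-α) := by gcongr
    linarith

lemma exists_integral_one_add_rpow_mul_sub_rpow_le {α : ℝ} (hα : 0 < α) (hα1 : α < 1) :
    ∃ K : ℝ, 0 < K ∧ ∀ t : ℝ, 0 < t →
      ∫ s in Ioo 0 t, (1 + s) ^ (-α - 1) * (t - s) ^ (-α) ≤ K * (1 + t) ^ (-α) := by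
  have h1α : 0 < 1 - α := sub_pos.2 hα1
  refine ⟨2 ^ α * (1 / α) + 2 ^ (α + 1) * (1 / (1 - α)), by positivity, fun t ht => ?_⟩
  set m : ℝ := (1 + t) / 2 with hm
  have hm0 : 0 < m := by positivity
  have hi1 : IntegrableOn (fun s : ℝ => (1 + s) ^ (-α - 1)) (Ioo 0 t) := by
    simpa using integrableOn_one_add_rpow_mul_sub_rpow (α := 0) one_pos ht (-α - 1)
  have hi2 : IntegrableOn (fun s : ℝ => (t - s) ^ (-α)) (Ioo 0 t) := by
    simpa using integrableOn_one_add_rpow_mul_sub_rpow hα1 ht 0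
  have hm1 : m ^ (-α) = 2 ^ α * (1 + t) ^ (-α) := by
    rw [hm, Real.div_rpow (by positivity) (by norm_num), Real.rpow_neg (by norm_num : (0:ℝ) ≤ 2)]
    field_simp
  have hm2 : m ^ (-α - 1) * t ^ (1 - α) ≤ 2 ^ (α + 1) * (1 + t) ^ (-α) := by
    have hle : t ^ (1 - α) ≤ 1 + t :=
      (Real.rpow_le_rpow ht.le (by linarith) h1α.le).trans
        ((Real.rpow_le_rpow_of_exponent_le (by linarith) (by linarith)).trans_eq
          (Real.rpow_one _))
    calc m ^ (-α - 1) * t ^ (1 - α) ≤ m ^ (-α - 1) * (1 + t) := by gcongr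
      _ = 2 ^ (α + 1) * (1 + t) ^ (-α) := by
        rw [Real.rpow_sub_one hm0.ne', hm1, Real.rpow_add_one (by norm_num), hm]
        field_simp
  calc ∫ s in Ioo 0 t, (1 + s) ^ (-α - 1) * (t - s) ^ (-α)
      ≤ ∫ s in Ioo 0 t, (m ^ (-α) * (1 + s) ^ (-α - 1) + m ^ (-α - 1) * (t - s) ^ (-α)) := by
        refine setIntegral_mono_on (integrableOn_one_add_rpow_mul_sub_rpow hα1 ht _)
          ((hi1.const_mul _).add (hi2.const_mul _)) measurableSet_Ioo fun s hs => ?_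
        exact rpow_mul_rpow_le_add hα (sub_pos.2 hs.2) (by linarith [hs.1]) hm0
          (by rw [hm]; linarith)
    _ = m ^ (-α) * (∫ s in Ioo 0 t, (1 + s) ^ (-α - 1)) +
          m ^ (-α - 1) * t ^ (1 - α) * (1 / (1 - α)) := by
        rw [integral_add (hi1.const_mul _) (hi2.const_mul _), integral_const_mul,
          integral_const_mul, integral_sub_rpow hα1 ht]
        ring
    _ ≤ 2 ^ α * (1 + t) ^ (-α) * (1 / α) + 2 ^ (α + 1) * (1 + t) ^ (-α) * (1 / (1 - α)) := by
        rw [hm1]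
        gcongr
        exact integral_one_add_rpow_le hα ht
    _ = _ := by ring

/-- The function `t ↦ (1 + t) ^ (-α)` dominates `t ↦ E_{α,1}(-c t ^ α)` for a suitable `c`. -/
lemma exists_mittagLeffler_one_le_one_add_rpow {α : ℝ} (hα : α ∈ Ioo (0 : ℝ) 1) :
    ∃ c : ℝ, 0 < c ∧ ∀ t : ℝ, 0 < t →
      mittagLeffler α 1 (-(c * t ^ α)) ≤ (1 + t) ^ (-α) := by
  have hα0 := hα.1
  have hΓ : 0 < Real.Gamma (1 - α) := Real.Gamma_pos_of_pos (sub_pos.2 hα.2)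
  obtain ⟨K, hK, hKle⟩ := exists_integral_one_add_rpow_mul_sub_rpow_le hα.1 hα.2
  set c : ℝ := α * K / Real.Gamma (1 - α) with hc
  refine ⟨c, by positivity, fun t ht => ?_⟩
  set f : ℝ → ℝ := fun s => (1 + s) ^ (-α) - mittagLeffler α 1 (-(c * s ^ α)) with hf
  set g : ℝ → ℝ := fun s => s ^ (α - 1) * mittagLeffler α α (-(c * s ^ α)) with hg
  set f' : ℝ → ℝ := fun s => -α * (1 + s) ^ (-α - 1) + c * g s with hf'
  by_contra! hlt
  have hcα : Continuous fun s : ℝ => -(c * s ^ α) :=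
    (continuous_const.mul (Real.continuous_rpow_const hα0.le)).neg
  have hfc : ContinuousOn f (Ici 0) := by
    refine ContinuousOn.sub ?_ ((continuous_mittagLeffler hα0 one_pos).comp hcα).continuousOn
    exact ContinuousOn.rpow_const (by fun_prop) fun s (hs : 0 ≤ s) => Or.inl (by linarith)
  have hfd : ∀ s, 0 < s → HasDerivAt f (f' s) s := by
    intro s hs
    have h1 : HasDerivAt (fun u : ℝ => (1 + u) ^ (-α)) (1 * (-α) * (1 + s) ^ (-α - 1)) s :=
      ((hasDerivAt_id s).const_add 1).rpow_const (Or.inl (by simp only [id]; linarith))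
    have h2 : HasDerivAt (fun u : ℝ => -(c * u ^ α)) (-(c * (α * s ^ (α - 1)))) s :=
      ((Real.hasDerivAt_rpow_const (Or.inl hs.ne')).const_mul c).neg
    have h3 := (hasDerivAt_mittagLeffler_one hα0 (-(c * s ^ α))).comp s h2
    refine (h1.sub h3).congr_deriv ?_
    simp only [hf', hg]
    field_simp
    ring
  have hf'c : ContinuousOn f' (Ioi 0) := by
    refine ContinuousOn.add (continuousOn_const.mul ?_) (continuousOn_const.mul (.mul ?_ ?_))
    · exact ContinuousOn.rpow_const (by fun_prop) fun s (hs : 0 < s) => Or.inl (by linarith)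
    · exact ContinuousOn.rpow_const (by fun_prop) fun s (hs : 0 < s) => Or.inl hs.ne'
    · exact ((continuous_mittagLeffler hα0 hα0).comp hcα).continuousOn
  obtain ⟨T, hTmem, hTmin⟩ := isCompact_Icc.exists_isMinOn (nonempty_Icc.2 ht.le)
    (hfc.mono fun s (hs : s ∈ Icc 0 t) => hs.1)
  have hfT : f T < 0 := (hTmin ⟨ht.le, le_rfl⟩).trans_lt (sub_neg.2 hlt)
  have hf0 : f 0 = 0 := by
    simp [hf, Real.zero_rpow hα0.ne', mittagLeffler_one_zero]
  have hT : 0 < T := by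
    refine lt_of_le_of_ne hTmem.1 ?_
    rintro rfl
    exact hfT.ne hf0
  have hi1 := (integrableOn_one_add_rpow_mul_sub_rpow hα.2 hT (-α - 1)).const_mul (-α)
  have hi2 := (integrableOn_rpow_mul_mittagLeffler_mul_sub_rpow hα c hT).const_mul c
  have heq : (fun s => f' s * (T - s) ^ (-α)) = fun s =>
      -α * ((1 + s) ^ (-α - 1) * (T - s) ^ (-α)) +
        c * (s ^ (α - 1) * mittagLeffler α α (-(c * s ^ α)) * (T - s) ^ (-α)) := by
    funext s
    simp only [hf', hg]
    ring
  have hnonpos := integral_sub_rpow_mul_deriv_nonpos hα0 hα.2 hT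
    (hfc.mono fun s hs => hs.1) hfd hf'c (by rw [heq]; exact hi1.add hi2)
    fun s hs => hTmin ⟨hs.1, hs.2.trans hTmem.2⟩
  rw [heq, integral_add hi1 hi2, integral_const_mul, integral_const_mul,
    integral_rpow_mul_mittagLeffler_mul_sub_rpow hα c hT, ← mul_assoc c, hc,
    div_mul_cancel₀ _ hΓ.ne', ← hc] at hnonpos
  have h1 := mul_le_mul_of_nonneg_left (hKle T hT) hα0.le
  have h2 : α * K * f T < 0 := mul_neg_of_pos_of_neg (by positivity) hfT
  simp only [hf] at h2
  linarith

lemma exists_mittagLeffler_one_neg_le_div {α : ℝ} (hα : α ∈ Ioo (0 : ℝ) 1) :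
    ∃ c : ℝ, 0 < c ∧ ∀ x : ℝ, 0 < x → mittagLeffler α 1 (-x) ≤ c / x := by
  have hα0 := hα.1
  obtain ⟨c, hc, hle⟩ := exists_mittagLeffler_one_le_one_add_rpow hα
  refine ⟨c, hc, fun x hx => ?_⟩
  have ht : 0 < (x / c) ^ (1 / α) := by positivity
  have htα : ((x / c) ^ (1 / α)) ^ α = x / c := by
    rw [← Real.rpow_mul (by positivity), one_div_mul_cancel hα0.ne', Real.rpow_one]
  have h := (hle _ ht).trans
    (Real.rpow_le_rpow_of_nonpos ht (by linarith : _ ≤ 1 + (x / c) ^ (1 / α))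
      (by linarith : -α ≤ 0))
  rwa [Real.rpow_neg ht.le, htα, mul_div_cancel₀ _ hc.ne', inv_div] at h

theorem stmt12
    (α : ℝ) (hα : α ∈ Ioo (0:ℝ) 1) :
    ∃ C : ℝ, 0 < C ∧
      ∀ c₀ : ℝ, 0 < c₀ → ∀ t : ℝ, 0 < t →
        (∫ s in Ioo (0:ℝ) t,
            (t - s) ^ (α - 1) * mittagLeffler α α (-(c₀ * (t - s) ^ α)) * s ^ (-α)) ≤
          C / c₀ * t ^ (-α) := by
  have hΓ : 0 < Real.Gamma (1 - α) := Real.Gamma_pos_of_pos (sub_pos.2 hα.2)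
  obtain ⟨c, hc, hle⟩ := exists_mittagLeffler_one_neg_le_div hα
  refine ⟨Real.Gamma (1 - α) * c, by positivity, fun c₀ hc₀ t ht => ?_⟩
  have hrefl : (∫ s in Ioo (0:ℝ) t,
      (t - s) ^ (α - 1) * mittagLeffler α α (-(c₀ * (t - s) ^ α)) * s ^ (-α)) =
      ∫ s in Ioo 0 t, s ^ (α - 1) * mittagLeffler α α (-(c₀ * s ^ α)) * (t - s) ^ (-α) := by
    have h := intervalIntegral.integral_comp_sub_left (a := 0) (b := t)
      (fun s => s ^ (α - 1) * mittagLeffler α α (-(c₀ * s ^ α)) * (t - s) ^ (-α)) t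
    simpa only [sub_sub_cancel, sub_self, sub_zero, intervalIntegral.integral_of_le ht.le,
      integral_Ioc_eq_integral_Ioo] using h
  have htα : 0 < t ^ α := by positivity
  rw [hrefl, integral_rpow_mul_mittagLeffler_mul_sub_rpow hα c₀ ht]
  calc Real.Gamma (1 - α) * mittagLeffler α 1 (-(c₀ * t ^ α))
      ≤ Real.Gamma (1 - α) * (c / (c₀ * t ^ α)) := by
        gcongr
        exact hle _ (by positivity)
    _ = Real.Gamma (1 - α) * c / c₀ * t ^ (-α) := by
        rw [Real.rpow_neg ht.le]
        field_simp
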